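/- Let f ∈ F_{μ,L}(ℝⁿ) with minimizer x_*, let 0 ≤ ε ≤ 2μ/(L+μ), and let 0 ≤ γ ≤ (2μ − ε(L+μ))/((1−ε)μ(L+μ)). If x₁ = x₀ − γd where ‖d − g(x₀)‖ ≤ ε‖g(x₀)‖, then f(x₁) − f(x_*) ≤ (1 − (1−ε)μγ)²·(f(x₀) − f(x_*)). -/

import Mathlib

open scoped RealInnerProductSpace

section aux
variable {E : Type*} [NormedAddCommGroup E] [InnerProductSpace ℝ E] [CompleteSpace E]

lemma aux_line (f : E → ℝ) (hdiff : Differentiable ℝ f) (x v : E) (t : ℝ) :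
    HasDerivAt (fun t : ℝ => f (x + t • v)) ⟪gradient f (x + t • v), v⟫ t := by
  have h1 : HasDerivAt (fun t : ℝ => x + t • v) v t := by
    simpa using ((hasDerivAt_id t).smul_const v).const_add x
  have h2 := (hdiff (x + t • v)).hasGradientAt.hasFDerivAt
  have h3 := h2.comp_hasDerivAt t h1
  simpa [Function.comp_def] using h3

lemma aux_descent (f : E → ℝ) (L : ℝ) (hdiff : Differentiable ℝ f)
    (hlip : ∀ x y, ‖gradient f x - gradient f y‖ ≤ L * ‖x - y‖) (x v : E) :
    f (x + v) ≤ f x + ⟪gradient f x, v⟫ + L / 2 * ‖v‖ ^ 2 := by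
  let φ : ℝ → ℝ := fun t => f (x + t • v) - t * ⟪gradient f x, v⟫ - t ^ 2 * (L / 2 * ‖v‖ ^ 2)
  have hφ : ∀ t, HasDerivAt φ (⟪gradient f (x + t • v), v⟫ - ⟪gradient f x, v⟫
      - 2 * t * (L / 2 * ‖v‖ ^ 2)) t := by
    intro t
    have h1 := aux_line f hdiff x v t
    have h2 := (hasDerivAt_id t).mul_const (⟪gradient f x, v⟫)
    have h3 := (hasDerivAt_pow 2 t).mul_const (L / 2 * ‖v‖ ^ 2)
    have := (h1.sub h2).sub h3
    refine HasDerivAt.congr_deriv this ?_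
    norm_num
  have hanti : AntitoneOn φ (Set.Icc 0 1) := by
    apply antitoneOn_of_deriv_nonpos (convex_Icc 0 1)
    · exact fun t _ => (hφ t).continuousAt.continuousWithinAt
    · exact fun t _ => (hφ t).differentiableAt.differentiableWithinAt
    · intro t ht
      rw [interior_Icc] at ht
      rw [(hφ t).deriv, ← inner_sub_left]
      have h1 := real_inner_le_norm (gradient f (x + t • v) - gradient f x) v
      have h2 := hlip (x + t • v) x
      rw [add_sub_cancel_left, norm_smul, Real.norm_of_nonneg ht.1.le] at h2
      nlinarith [norm_nonneg v, mul_le_mul_of_nonneg_right h2 (norm_nonneg v)]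
  have := hanti (Set.left_mem_Icc.2 zero_le_one) (Set.right_mem_Icc.2 zero_le_one) zero_le_one
  simp only [φ, one_smul, zero_smul, add_zero] at this
  linarith

lemma aux_convex (f : E → ℝ) (μ : ℝ) (hdiff : Differentiable ℝ f)
    (hsc : ConvexOn ℝ Set.univ (fun x => f x - μ / 2 * ‖x‖ ^ 2)) (x v : E) :
    f x + ⟪gradient f x, v⟫ + μ / 2 * ‖v‖ ^ 2 ≤ f (x + v) := by
  let φ : ℝ → ℝ := fun t => f (x + t • v) - μ / 2 * (‖x‖ ^ 2 + t * (2 * ⟪x, v⟫) + t ^ 2 * ‖v‖ ^ 2)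
  have he : ∀ t : ℝ, φ t = f (x + t • v) - μ / 2 * ‖x + t • v‖ ^ 2 := by
    intro t
    simp only [φ]
    rw [norm_add_sq_real, norm_smul, inner_smul_right, mul_pow, Real.norm_eq_abs, sq_abs]
    ring
  have hc : ConvexOn ℝ Set.univ φ := by
    refine ⟨convex_univ, ?_⟩
    intro a _ b _ p q hp hq hpq
    have := hsc.2 (Set.mem_univ (x + a • v)) (Set.mem_univ (x + b • v)) hp hq hpq
    rw [he, he, he]
    have h2 : p • (x + a • v) + q • (x + b • v) = x + (p • a + q • b) • v := by
      have : x = (p + q) • x := by rw [hpq, one_smul]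
      conv_rhs => rw [this]
      simp only [smul_eq_mul]
      module
    rw [h2] at this
    exact this
  have hφ : HasDerivAt φ (⟪gradient f x, v⟫ - μ * ⟪x, v⟫) 0 := by
    have h1 := aux_line f hdiff x v 0
    have h2 := (hasDerivAt_id (0:ℝ)).mul_const (2 * ⟪x, v⟫)
    have h3 := (hasDerivAt_pow 2 (0:ℝ)).mul_const (‖v‖ ^ 2)
    have := h1.sub (((h2.const_add (‖x‖ ^ 2)).add h3).const_mul (μ / 2))
    refine HasDerivAt.congr_deriv this ?_
    rw [zero_smul, add_zero]
    ring
  have := hc.le_slope_of_hasDerivAt (Set.mem_univ 0) (Set.mem_univ 1) zero_lt_one hφ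
  simp only [slope, φ, one_smul, zero_smul, add_zero, vsub_eq_sub, smul_eq_mul] at this
  rw [sub_zero, inv_one, one_mul] at this
  linarith

lemma aux_interp (f : E → ℝ) (μ L : ℝ) (hμL : μ < L) (hdiff : Differentiable ℝ f)
    (hsc : ConvexOn ℝ Set.univ (fun x => f x - μ / 2 * ‖x‖ ^ 2))
    (hlip : ∀ x y, ‖gradient f x - gradient f y‖ ≤ L * ‖x - y‖) (x y : E) :
    ‖gradient f y - gradient f x - μ • (y - x)‖ ^ 2 ≤
    2 * (L - μ) * (f y - f x - ⟪gradient f x, y - x⟫ - μ / 2 * ‖y - x‖ ^ 2) := by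
  have hK : 0 < L - μ := by linarith
  obtain ⟨r, hr⟩ : ∃ r, r = gradient f y - gradient f x - μ • (y - x) := ⟨_, rfl⟩
  obtain ⟨u, hu⟩ : ∃ u, u = y - x := ⟨_, rfl⟩
  obtain ⟨k, hk⟩ : ∃ k, k = (L - μ)⁻¹ := ⟨_, rfl⟩
  have hkK : k * (L - μ) = 1 := by rw [hk]; field_simp
  have h1 := aux_descent f L hdiff hlip y (-(k • r))
  have h2 := aux_convex f μ hdiff hsc x (u - k • r)
  have e : x + (u - k • r) = y + -(k • r) := by rw [hu]; abel
  rw [e] at h2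
  have hgy : gradient f y = r + gradient f x + μ • u := by rw [hr, hu]; abel
  rw [← hr, ← hu]
  rw [hgy] at h1
  simp only [← real_inner_self_eq_norm_sq, inner_add_left, inner_add_right, inner_sub_left,
    inner_sub_right, inner_neg_left, inner_neg_right, real_inner_smul_left,
    real_inner_smul_right] at h1 h2 ⊢
  rw [real_inner_comm u r] at *
  generalize ⟪gradient f x, r⟫ = a at *
  generalize ⟪gradient f x, u⟫ = b at *
  generalize ⟪u, u⟫ = c at *
  generalize ⟪r, r⟫ = R at *
  generalize f (y + -(k • r)) = F at *
  have h3 : k * R / 2 ≤ f y - f x - b - μ / 2 * c := by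
    have : k * (k * R) * (L - μ) = k * R := by linear_combination k * R * hkK
    nlinarith
  have := mul_le_mul_of_nonneg_left h3 (by linarith : 0 ≤ 2 * (L - μ))
  calc R = 2 * (L - μ) * (k * R / 2) := by linear_combination -R * hkK
    _ ≤ _ := this

lemma aux_final (μ L δ η ρ f0 f1 fs : ℝ) (hμ : 0 < μ) (hμL : μ < L) (hδ : 0 ≤ δ) (hη : 0 ≤ η)
    (hρ : ρ = 1 - μ * δ) (hD : 2 * L * η ≤ 2 * ρ - δ * (L - μ))
    (X S w T Y : E) (hY : Y = ρ • X - δ • S - w)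
    (hw : ‖w‖ ^ 2 ≤ 2 * η * ⟪w, S + μ • X⟫)
    (I1 : ‖S - T‖ ^ 2 ≤ 2 * (L - μ) * (f0 - f1 - ⟪T + μ • Y, X - Y⟫ - μ / 2 * ‖X - Y‖ ^ 2))
    (I2 : ‖S‖ ^ 2 ≤ 2 * (L - μ) * (fs - f0 + ⟪S + μ • X, X⟫ - μ / 2 * ‖X‖ ^ 2))
    (I3 : ‖T‖ ^ 2 ≤ 2 * (L - μ) * (fs - f1 + ⟪T + μ • Y, Y⟫ - μ / 2 * ‖Y‖ ^ 2)) :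
    f1 - fs ≤ ρ ^ 2 * (f0 - fs) := by
  have hK : 0 < L - μ := by linarith
  obtain ⟨K, hKd⟩ : ∃ K, K = L - μ := ⟨_, rfl⟩
  have hL : 0 < L := by linarith
  have hρ0 : 0 ≤ ρ := by nlinarith [mul_nonneg hL.le hη, mul_nonneg hδ hK.le]
  have hρ1 : 0 ≤ 1 - ρ := by rw [hρ]; nlinarith
  obtain ⟨D, hDd⟩ : ∃ D, D = 2 * ρ - δ * K := ⟨_, rfl⟩
  rw [← hKd] at hK hD I1 I2 I3
  rw [← hDd] at hD
  have hR : L * K * ‖w‖ ^ 2 - 2 * K * ρ * ⟪w, S + μ • X⟫ + 2 * K * L * δ * ⟪w, S⟫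
      - L * δ * D * ‖S‖ ^ 2 ≤ 0 := by
    rcases hη.eq_or_lt with h0 | h0
    · rw [← h0] at hw
      have : w = 0 := by
        have : ‖w‖ ^ 2 = 0 := le_antisymm (by linarith) (by positivity)
        simpa using this
      rw [← h0] at hD
      have : 0 ≤ D := by linarith
      subst w
      simp
      positivity
    · have hDp : 0 < D := lt_of_lt_of_le (by positivity) hD
      have hy : 0 ≤ ‖K • w - D • S‖ ^ 2 := by positivity
      rw [norm_sub_sq_real, norm_smul, norm_smul, real_inner_smul_left, real_inner_smul_right,
        mul_pow, mul_pow, Real.norm_eq_abs, Real.norm_eq_abs, sq_abs, sq_abs] at hy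
      have hp : 0 ≤ ⟪w, S + μ • X⟫ := by
        by_contra h
        have := mul_neg_of_pos_of_neg (by positivity : 0 < 2 * η) (not_le.1 h)
        nlinarith [sq_nonneg ‖w‖]
      generalize ⟪w, S + μ • X⟫ = p at *
      generalize ⟪w, S⟫ = q at *
      have hW0 := sq_nonneg ‖w‖
      generalize ‖w‖ ^ 2 = W at *
      generalize ‖S‖ ^ 2 = s at *
      have a1 : L * W ≤ D * p := by
        calc L * W ≤ L * (2 * η * p) := by gcongr
          _ = 2 * L * η * p := by ring
          _ ≤ D * p := by gcongr
      have a2 := mul_nonneg (mul_nonneg hL.le hδ) hy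
      have a3 := mul_le_mul_of_nonneg_left a1 (by positivity : 0 ≤ 2 * K * ρ)
      have : D * (L * K * W - 2 * K * ρ * p + 2 * K * L * δ * q - L * δ * D * s) ≤ 0 := by
        have : D * (L * K * W) = 2 * K * ρ * (L * W) - L * δ * K ^ 2 * W := by rw [hDd]; ring
        nlinarith
      by_contra h
      have := mul_pos hDp (not_le.1 h)
      linarith
  have hsq : 0 ≤ ‖(ρ - δ * K) • S - K • w - T‖ ^ 2 := by positivity
  have J1 := mul_le_mul_of_nonneg_left I1 hρ0
  have J2 := mul_le_mul_of_nonneg_left I2 (mul_nonneg hρ0 hρ1)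
  have J3 := mul_le_mul_of_nonneg_left I3 hρ1
  suffices 0 ≤ 2 * K * (ρ ^ 2 * (f0 - fs) - (f1 - fs)) by
    by_contra h
    have := mul_pos (by positivity : 0 < 2 * K) (sub_pos.2 (not_le.1 h))
    linarith
  subst hY
  clear I1 I2 I3 hw
  simp only [← real_inner_self_eq_norm_sq, inner_add_left, inner_add_right, inner_sub_left,
    inner_sub_right, real_inner_smul_left,
    real_inner_smul_right, real_inner_comm X S, real_inner_comm X T, real_inner_comm X w,
    real_inner_comm S T, real_inner_comm S w, real_inner_comm T w] at J1 J2 J3 hR hsq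
  have hL2 : L = K + μ := by linarith
  subst hDd hL2 hρ
  linarith

end aux

/-- Inexact gradient method with fixed step length on `f ∈ F_{μ,L}(ℝⁿ)`:
worst-case contraction of the function value gap. -/
theorem stmt9 {n : ℕ} (f : EuclideanSpace ℝ (Fin n) → ℝ) (μ L : ℝ)
    (hμ : 0 < μ) (hμL : μ < L)
    (hdiff : Differentiable ℝ f)
    -- μ-strong convexity
    (hsc : ConvexOn ℝ Set.univ (fun x => f x - μ / 2 * ‖x‖ ^ 2))
    -- L-Lipschitz gradient
    (hlip : ∀ x y, ‖gradient f x - gradient f y‖ ≤ L * ‖x - y‖)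
    (xstar x₀ x₁ d : EuclideanSpace ℝ (Fin n)) (γ ε : ℝ)
    (hmin : ∀ x, f xstar ≤ f x)
    (hε0 : 0 ≤ ε) (hε1 : ε ≤ 2 * μ / (L + μ))
    (hγ0 : 0 ≤ γ) (hγ1 : γ ≤ (2 * μ - ε * (L + μ)) / ((1 - ε) * μ * (L + μ)))
    (hstep : x₁ = x₀ - γ • d)
    (hd : ‖d - gradient f x₀‖ ≤ ε * ‖gradient f x₀‖) :
    f x₁ - f xstar ≤ (1 - (1 - ε) * μ * γ) ^ 2 * (f x₀ - f xstar) := by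
  have hgs : gradient f xstar = 0 := by
    have : IsLocalMin f xstar := Filter.Eventually.of_forall hmin
    simp [gradient, this.fderiv_eq_zero]
  have hL : 0 < L := by linarith
  have hLm : 0 < L + μ := by linarith
  have hεlt : 0 < 1 - ε := by
    have : 2 * μ / (L + μ) < 1 := by rw [div_lt_one hLm]; linarith
    linarith
  rw [le_div_iff₀ (by positivity)] at hγ1
  have hγ2 : γ * (L + μ) ≤ 2 := by
    have : (1 - ε) * μ * (γ * (L + μ)) ≤ (1 - ε) * μ * 2 := by nlinarith
    exact le_of_mul_le_mul_left this (by positivity)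
  have hγ3 : 2 * L * μ * γ ≤ L + μ := by
    have : (L + μ) * (2 * L * μ * γ) ≤ (L + μ) * (L + μ) := by
      have := mul_le_mul_of_nonneg_left hγ2 (by positivity : 0 ≤ 2 * L * μ)
      nlinarith [sq_nonneg (L - μ)]
    exact le_of_mul_le_mul_left this hLm
  have hD : 2 * L * (ε * γ) ≤ 2 * (1 - (1 - ε) * μ * γ) - ((1 - ε) * γ) * (L - μ) := by
    have : μ * (2 * L * (ε * γ)) ≤
        μ * (2 * (1 - (1 - ε) * μ * γ) - ((1 - ε) * γ) * (L - μ)) := by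
      have := mul_le_mul_of_nonneg_left hγ3 hε0
      nlinarith
    exact le_of_mul_le_mul_left this hμ
  have key := aux_interp f μ L hμL hdiff hsc hlip
  have i1 := key x₁ x₀
  have i2 := key x₀ xstar
  have i3 := key x₁ xstar
  obtain ⟨X, hX⟩ : ∃ X, X = x₀ - xstar := ⟨_, rfl⟩
  obtain ⟨Y, hY⟩ : ∃ Y, Y = x₁ - xstar := ⟨_, rfl⟩
  obtain ⟨S, hS⟩ : ∃ S, S = gradient f x₀ - μ • X := ⟨_, rfl⟩
  obtain ⟨T, hT⟩ : ∃ T, T = gradient f x₁ - μ • Y := ⟨_, rfl⟩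
  have e0 : gradient f x₀ = S + μ • X := by rw [hS]; abel
  have e1 : gradient f x₁ = T + μ • Y := by rw [hT]; abel
  have e2 : x₀ - x₁ = X - Y := by rw [hX, hY]; abel
  have e3 : xstar - x₀ = -X := by rw [hX]; abel
  have e4 : xstar - x₁ = -Y := by rw [hY]; abel
  rw [e0, e1, e2] at i1
  rw [e0, e3, hgs] at i2
  rw [e1, e4, hgs] at i3
  refine aux_final μ L ((1 - ε) * γ) (ε * γ) (1 - (1 - ε) * μ * γ) (f x₀) (f x₁) (f xstar)
    hμ hμL (by positivity) (by positivity) (by ring) hD X S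
    (γ • (d - (1 - ε) • gradient f x₀)) T Y ?_ ?_ ?_ ?_ ?_
  · rw [hY, hstep, e0]
    have : x₀ = X + xstar := by rw [hX]; abel
    rw [this]
    module
  · rw [← e0]
    have h2 : ‖d - gradient f x₀‖ ^ 2 ≤ (ε * ‖gradient f x₀‖) ^ 2 := by gcongr
    generalize gradient f x₀ = g at *
    rw [mul_pow] at h2
    simp only [← real_inner_self_eq_norm_sq, inner_sub_left, inner_sub_right, 
      real_inner_smul_left, real_inner_smul_right, real_inner_comm g d] at h2 ⊢
    simp only [real_inner_comm d g] at h2 ⊢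
    have := mul_le_mul_of_nonneg_left h2 (sq_nonneg γ)
    nlinarith
  · convert i1 using 3
    module
  · convert i2 using 2
    · rw [← norm_neg]; congr 2; module
    · rw [inner_neg_right, norm_neg]; ring
  · convert i3 using 2
    · rw [← norm_neg]; congr 2; module
    · rw [inner_neg_right, norm_neg]; ring
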